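/- Let X be a metric space, let k ≥ 1, and suppose there exist metric spaces Y and Z together with isometric equivalences X ≃ ℝᵏ ×₂ Y (a k-splitting) and X ≃ ℝ ×₂ Z (a 1-splitting), where ℝᵏ = EuclideanSpace ℝ (Fin k) and ×₂ is the ℓ²-product. Then either Z is isometric to ℝ^{k−1} ×₂ Y, or there exists a metric space W such that Y is isometric to ℝ ×₂ W and Z is isometric to ℝᵏ ×₂ W. (This is the dichotomy of Kleiner–Lott, 'Locally Collapsed 3-Manifolds', Lemma 4.3, part (1): a 1-splitting is either compatible with a given k-splitting, or the k-splitting extends to a (k+1)-splitting with which the 1-splitting is compatible.) -/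

import Mathlib

universe u

/-- If two triangles satisfy the triangle inequality and their side lengths combine in `ℓ²` to a
degenerate triangle, then both are degenerate, with sides in the same proportion. -/
lemma degenerate_of_l2_degenerate {a b c a' b' c' m n : ℝ} (hc : 0 ≤ c) (hc' : 0 ≤ c')
    (hm : 0 ≤ m) (hn : 0 ≤ n)
    (h₁ : a ^ 2 + a' ^ 2 = m ^ 2) (h₂ : b ^ 2 + b' ^ 2 = n ^ 2)
    (h₃ : c ^ 2 + c' ^ 2 = (m + n) ^ 2) (h : c ≤ a + b) (h' : c' ≤ a' + b') :
    n * a = m * b ∧ c = a + b := by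
  have hsq : c ^ 2 ≤ (a + b) ^ 2 := pow_le_pow_left₀ hc h 2
  have hsq' : c' ^ 2 ≤ (a' + b') ^ 2 := pow_le_pow_left₀ hc' h' 2
  have hlow : m * n ≤ a * b + a' * b' := by nlinarith
  have hup : a * b + a' * b' ≤ m * n := by
    refine abs_le_of_sq_le_sq' ?_ (by positivity) |>.2
    have : (m * n) ^ 2 = (a ^ 2 + a' ^ 2) * (b ^ 2 + b' ^ 2) := by rw [h₁, h₂]; ring
    nlinarith [sq_nonneg (a * b' - a' * b)]
  have heq : a * b + a' * b' = m * n := le_antisymm hup hlow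
  constructor
  · have : (n * a - m * b) ^ 2 + (n * a' - m * b') ^ 2 = 0 := by
      linear_combination n ^ 2 * h₁ + m ^ 2 * h₂ - 2 * m * n * heq
    nlinarith [sq_nonneg (n * a - m * b), sq_nonneg (n * a' - m * b')]
  · refine le_antisymm h ?_
    refine abs_le_of_sq_le_sq' (a := a + b) ?_ hc |>.2
    nlinarith

lemma eq_zero_of_forall_quadratic_nonneg {a b : ℝ} (h : ∀ x : ℝ, 0 ≤ a * x ^ 2 + b * x) :
    b = 0 := by
  have := discrim_le_zero (a := a) (b := b) (c := 0) fun x => by nlinarith [h x]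
  rw [discrim] at this
  nlinarith [sq_nonneg b]

/-- A surjective isometry `ℝ ×₂ Z → E ×₂ Y`, given by its two components. -/
structure IsProductIsometry {E Y Z : Type*} [NormedAddCommGroup E] [MetricSpace Y] [MetricSpace Z]
    (P : ℝ → Z → E) (S : ℝ → Z → Y) : Prop where
  sq_add_sq : ∀ t z s z',
    ‖P t z - P s z'‖ ^ 2 + dist (S t z) (S s z') ^ 2 = (t - s) ^ 2 + dist z z' ^ 2
  surjective : ∀ p y, ∃ t z, P t z = p ∧ S t z = y

lemma WithLp.prod_dist_sq {A B : Type*} [MetricSpace A] [MetricSpace B]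
    (x y : WithLp 2 (A × B)) :
    dist x y ^ 2 = dist x.fst y.fst ^ 2 + dist x.snd y.snd ^ 2 := by
  rw [WithLp.prod_dist_eq_add (by norm_num), ← Real.rpow_natCast, ← Real.rpow_mul (by positivity)]
  simp

/-- The level set `{y | b (0, y) = 0}`, where `b` is the `ℝ`-coordinate on `E ×₂ Y ≃ ℝ ×₂ Z`. -/
abbrev SplittingLevel {E Y Z : Type*} [Zero E] (P : ℝ → Z → E) (S : ℝ → Z → Y) : Type _ :=
  {y : Y // ∃ z, P 0 z = 0 ∧ S 0 z = y}

namespace IsProductIsometry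

variable {E Y Z : Type*} [NormedAddCommGroup E] [MetricSpace Y] [MetricSpace Z]
  {P : ℝ → Z → E} {S : ℝ → Z → Y}

lemma of_isometryEquiv (F : WithLp 2 (ℝ × Z) ≃ᵢ WithLp 2 (E × Y)) :
    IsProductIsometry (fun t z => (F (WithLp.toLp 2 (t, z))).fst)
      (fun t z => (F (WithLp.toLp 2 (t, z))).snd) where
  sq_add_sq t z s z' := by
    rw [← dist_eq_norm, ← WithLp.prod_dist_sq, F.dist_eq, WithLp.prod_dist_sq]
    simp [Real.dist_eq, sq_abs]
  surjective p y := by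
    refine ⟨(F.symm (WithLp.toLp 2 (p, y))).fst, (F.symm (WithLp.toLp 2 (p, y))).snd, ?_, ?_⟩
    · change (F (F.symm (WithLp.toLp 2 (p, y)))).fst = p
      simp
    · change (F (F.symm (WithLp.toLp 2 (p, y)))).snd = y
      simp

/-- Refining the splitting `E ×₂ Y` by a splitting `Y ≃ ℝ ×₂ W`. -/
lemma refine_snd {W : Type*} [MetricSpace W] (h : IsProductIsometry P S)
    (e : WithLp 2 (ℝ × W) ≃ᵢ Y) :
    IsProductIsometry (fun t z => WithLp.toLp 2 (P t z, (e.symm (S t z)).fst))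
      (fun t z => (e.symm (S t z)).snd) where
  sq_add_sq t z s z' := by
    rw [← h.sq_add_sq, ← e.symm.dist_eq, ← dist_eq_norm, WithLp.prod_dist_sq, WithLp.prod_dist_sq,
      ← dist_eq_norm]
    change dist (P t z) (P s z') ^ 2 + dist (e.symm (S t z)).fst (e.symm (S s z')).fst ^ 2 + _ = _
    ring
  surjective p w := by
    obtain ⟨t, z, hP, hS⟩ := h.surjective p.fst (e (WithLp.toLp 2 (p.snd, w)))
    refine ⟨t, z, ?_, ?_⟩ <;> simp [hP, hS]
    rfl

variable [InnerProductSpace ℝ E]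

lemma collinear (h : IsProductIsometry P S) (z : Z) {s t r : ℝ} (hst : s ≤ t) (htr : t ≤ r) :
    (r - t) • (P t z - P s z) = (t - s) • (P r z - P t z) := by
  have h₁ := h.sq_add_sq t z s z
  have h₂ := h.sq_add_sq r z t z
  have h₃ := h.sq_add_sq r z s z
  simp only [dist_self] at h₁ h₂ h₃
  have hadd : P r z - P s z = (P t z - P s z) + (P r z - P t z) := by abel
  obtain ⟨hp, hs⟩ := degenerate_of_l2_degenerate (a := ‖P t z - P s z‖) (b := ‖P r z - P t z‖)
    (a' := dist (S t z) (S s z)) (b' := dist (S r z) (S t z))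
    (norm_nonneg (P r z - P s z)) (dist_nonneg (x := S r z) (y := S s z)) (sub_nonneg.2 hst)
    (sub_nonneg.2 htr) (by linarith) (by linarith) (by linarith)
    (by rw [hadd]; exact norm_add_le _ _)
    (by rw [add_comm]; exact dist_triangle _ _ _)
  rw [hadd] at hs
  have hin := norm_add_sq_real (P t z - P s z) (P r z - P t z)
  rw [hs] at hin
  rw [← sub_eq_zero, ← norm_eq_zero, ← sq_eq_zero_iff, norm_sub_sq_real, norm_smul, norm_smul,
    real_inner_smul_left, real_inner_smul_right, Real.norm_of_nonneg (sub_nonneg.2 hst),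
    Real.norm_of_nonneg (sub_nonneg.2 htr), hp]
  linear_combination (r - t) * (t - s) * hin -
    2 * (t - s) * ‖P r z - P t z‖ * hp

lemma exists_velocity_at (h : IsProductIsometry P S) (z : Z) :
    ∃ v : E, ‖v‖ ≤ 1 ∧ ∀ t, P t z = P 0 z + t • v := by
  refine ⟨P 1 z - P 0 z, ?_, fun t => ?_⟩
  · have := h.sq_add_sq 1 z 0 z
    simp only [dist_self] at this
    refine abs_le_of_sq_le_sq' (b := 1) ?_ zero_le_one |>.2
    nlinarith [sq_nonneg (dist (S 1 z) (S 0 z))]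
  · rcases le_total t 0 with h0 | h0
    · have := h.collinear z h0 zero_le_one
      linear_combination (norm := module) (-1 : ℝ) • this
    rcases le_total t 1 with h1 | h1
    · have := h.collinear z h0 h1
      linear_combination (norm := module) (1 : ℝ) • this
    · have := h.collinear z zero_le_one h1
      linear_combination (norm := module) (-1 : ℝ) • this

lemma exists_velocity (h : IsProductIsometry P S) :
    ∃ v : E, ‖v‖ ≤ 1 ∧ ∀ z t s, P t z - P s z = (t - s) • v := by
  rcases isEmpty_or_nonempty Z with hZ | ⟨⟨z₀⟩⟩
  · exact ⟨0, by simp, fun z => hZ.elim z⟩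
  choose v hv1 hv using h.exists_velocity_at
  refine ⟨v z₀, hv1 z₀, fun z t s => ?_⟩
  have hvz : v z = v z₀ := by
    by_contra hne
    have hpos : 0 < ‖v z - v z₀‖ := norm_pos_iff.2 (sub_ne_zero.2 hne)
    obtain ⟨n, hn⟩ := exists_nat_gt ((dist z z₀ + ‖P 0 z - P 0 z₀‖) / ‖v z - v z₀‖)
    rw [div_lt_iff₀ hpos] at hn
    have hbound : ‖P n z - P n z₀‖ ≤ dist z z₀ := by
      have := h.sq_add_sq n z n z₀
      refine abs_le_of_sq_le_sq' ?_ dist_nonneg |>.2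
      nlinarith [sq_nonneg (dist (S n z) (S n z₀))]
    have hsplit : (n : ℝ) • (v z - v z₀) = (P n z - P n z₀) - (P 0 z - P 0 z₀) := by
      rw [hv z n, hv z₀ n, smul_sub]; abel
    have hnorm := norm_sub_le (P n z - P n z₀) (P 0 z - P 0 z₀)
    rw [← hsplit, norm_smul, Real.norm_natCast] at hnorm
    linarith
  rw [hv z t, hv z s, hvz, sub_smul]; abel

/-- The distance formula between two flow lines, based at arbitrary parameters. -/
lemma dist_sq_flow (h : IsProductIsometry P S) {v : E}
    (hv : ∀ z t s, P t z - P s z = (t - s) • v) (a a' t s : ℝ) (z z' : Z) :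
    dist (S (a + t) z) (S (a' + s) z') ^ 2 = dist (S a z) (S a' z') ^ 2
      + 2 * (t - s) * (a - a' - inner ℝ (P a z - P a' z') v)
      + (t - s) ^ 2 * (1 - ‖v‖ ^ 2) := by
  have h₁ := h.sq_add_sq (a + t) z (a' + s) z'
  have h₂ := h.sq_add_sq a z a' z'
  have hP : P (a + t) z - P (a' + s) z' = (P a z - P a' z') + (t - s) • v := by
    have e₁ := hv z (a + t) a
    have e₂ := hv z' (a' + s) a'
    rw [add_sub_cancel_left] at e₁ e₂
    rw [sub_smul, ← e₁, ← e₂]; abel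
  rw [hP, norm_add_sq_real, norm_smul, real_inner_smul_right, mul_pow, Real.norm_eq_abs,
    sq_abs] at h₁
  linear_combination h₁ - h₂

lemma sub_eq_inner (h : IsProductIsometry P S) {v : E}
    (hv : ∀ z t s, P t z - P s z = (t - s) • v) {a a' : ℝ} {z z' : Z} (hS : S a z = S a' z') :
    a - a' = inner ℝ (P a z - P a' z') v := by
  have := eq_zero_of_forall_quadratic_nonneg (a := 1 - ‖v‖ ^ 2)
    (b := 2 * (a - a' - inner ℝ (P a z - P a' z') v)) fun x => by
      have := h.dist_sq_flow hv a a' x 0 z z'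
      rw [hS, dist_self] at this
      nlinarith [sq_nonneg (dist (S (a + x) z) (S (a' + 0) z'))]
  linarith

/-- The flow on `E ×₂ Y` induced by translation in `ℝ` descends to a flow on `Y`. -/
lemma snd_flow_eq (h : IsProductIsometry P S) {v : E}
    (hv : ∀ z t s, P t z - P s z = (t - s) • v) {a a' : ℝ} {z z' : Z} (hS : S a z = S a' z')
    (t : ℝ) : S (a + t) z = S (a' + t) z' := by
  have := h.dist_sq_flow hv a a' t t z z'
  rw [hS] at this
  simpa using this

lemma nonempty_isometryEquiv_of_norm_eq_one (h : IsProductIsometry P S) {v : E}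
    (hv : ∀ z t s, P t z - P s z = (t - s) • v) (hv1 : ‖v‖ = 1) (n : ℕ)
    (hn : Module.finrank ℝ E = n + 1) :
    Nonempty (Z ≃ᵢ WithLp 2 (EuclideanSpace ℝ (Fin n) × Y)) := by
  have hv0 : v ≠ 0 := by rintro rfl; simp at hv1
  have : Fact (Module.finrank ℝ E = n + 1) := ⟨hn⟩
  let b := (OrthonormalBasis.fromOrthogonalSpanSingleton (𝕜 := ℝ) n hv0).repr
  let π := (Submodule.span ℝ {v})ᗮ.orthogonalProjectionOnto
  have hS : ∀ z t s, S t z = S s z := fun z t s => by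
    have := h.dist_sq_flow hv s s (t - s) 0 z z
    simpa [hv1] using this
  have hπv : π v = 0 := by
    rw [Submodule.orthogonalProjectionOnto_eq_zero_iff]
    exact Submodule.le_orthogonal_orthogonal _ (Submodule.mem_span_singleton_self v)
  have hπ : ∀ z z', ‖π (P 0 z) - π (P 0 z')‖ = ‖P 0 z - P 0 z'‖ := fun z z' => by
    have hin : inner ℝ v (P 0 z - P 0 z') = 0 := by
      have h₁ := h.dist_sq_flow hv 0 0 1 0 z z'
      rw [hS z (0 + 1) 0, hS z' (0 + 0) 0, hv1] at h₁
      rw [real_inner_comm]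
      linarith
    have hmem : P 0 z - P 0 z' ∈ (Submodule.span ℝ {v})ᗮ :=
      Submodule.mem_orthogonal_singleton_iff_inner_right.2 hin
    rw [← map_sub]
    exact congrArg norm
      (Submodule.orthogonalProjectionOnto_mem_subspace_eq_self
        (⟨_, hmem⟩ : (Submodule.span ℝ {v})ᗮ))
  let f : Z → WithLp 2 (EuclideanSpace ℝ (Fin n) × Y) :=
    fun z => WithLp.toLp 2 (b (π (P 0 z)), S 0 z)
  have hf : Isometry f := Isometry.of_dist_eq fun z z' => by
    rw [← sq_eq_sq₀ dist_nonneg dist_nonneg, WithLp.prod_dist_sq]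
    have := h.sq_add_sq 0 z 0 z'
    change dist (b (π (P 0 z))) (b (π (P 0 z'))) ^ 2 + dist (S 0 z) (S 0 z') ^ 2 = _
    rw [b.dist_map, dist_eq_norm, hπ, this]
    ring
  have hsurj : Function.Surjective f := fun x => by
    obtain ⟨t, z, hP, hSz⟩ := h.surjective (b.symm x.fst : E) x.snd
    refine ⟨z, ?_⟩
    have e : π (P 0 z) = b.symm x.fst := by
      have := congrArg π (hv z t 0)
      rw [map_sub, map_smul, hπv, smul_zero, sub_eq_zero, hP] at this
      rw [← this]
      exact Submodule.orthogonalProjectionOnto_mem_subspace_eq_self _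
    simp only [f, e, b.apply_symm_apply, hS z 0 t, hSz]
    rfl
  exact ⟨⟨Equiv.ofBijective f ⟨hf.injective, hsurj⟩, hf⟩⟩

/-- If the `ℝ`-factor is not contained in `E`, then `Y` splits off a line, along which the flow
moves with constant speed. -/
lemma exists_isometryEquiv_level (h : IsProductIsometry P S) {v : E}
    (hv : ∀ z t s, P t z - P s z = (t - s) • v) {c : ℝ} (hc : 0 < c)
    (hcv : ‖v‖ ^ 2 + c ^ 2 = 1) :
    ∃ e : WithLp 2 (ℝ × SplittingLevel P S) ≃ᵢ Y, ∀ z t s,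
      e.symm (S t z) = WithLp.toLp 2
        ((e.symm (S s z)).fst + (t - s) * c, (e.symm (S s z)).snd) := by
  choose ζ hζP hζS using fun w : SplittingLevel P S => w.2
  let f : WithLp 2 (ℝ × SplittingLevel P S) → Y := fun x => S (x.fst / c) (ζ x.snd)
  have hf : Isometry f := Isometry.of_dist_eq fun x y => by
    rw [← sq_eq_sq₀ dist_nonneg dist_nonneg, WithLp.prod_dist_sq]
    have := h.dist_sq_flow hv 0 0 (x.fst / c) (y.fst / c) (ζ x.snd) (ζ y.snd)
    rw [zero_add, zero_add, hζP, hζP, hζS, hζS, ← sub_div, ← hcv] at this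
    simp only [f, this, Real.dist_eq, sq_abs, Subtype.dist_eq]
    simp
    field_simp
    ring
  have hsurj : Function.Surjective f := fun y => by
    obtain ⟨b, z, hP, hS⟩ := h.surjective 0 y
    set τ : ℝ := -b / c ^ 2 with hτ
    obtain ⟨a, z', hP', hS'⟩ := h.surjective 0 (S (b + τ) z)
    have ha : a = 0 := by
      have e₁ := h.sub_eq_inner hv hS'.symm
      have e₂ := hv z (b + τ) b
      rw [hP, sub_zero, add_sub_cancel_left] at e₂
      rw [hP', sub_zero, e₂, real_inner_smul_left, real_inner_self_eq_norm_sq] at e₁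
      have : τ * c ^ 2 = -b := by rw [hτ]; field_simp
      linear_combination -e₁ + this - τ * hcv
    subst ha
    let w : SplittingLevel P S := ⟨S (b + τ) z, z', hP', hS'⟩
    refine ⟨WithLp.toLp 2 (-τ * c, w), ?_⟩
    have := h.snd_flow_eq hv (hζS w : S 0 (ζ w) = S (b + τ) z) (-τ)
    rw [zero_add, add_neg_cancel_right, hS] at this
    change S (-τ * c / c) (ζ w) = y
    rwa [mul_div_cancel_right₀ _ hc.ne']
  let e : WithLp 2 (ℝ × SplittingLevel P S) ≃ᵢ Y :=
    ⟨Equiv.ofBijective f ⟨hf.injective, hsurj⟩, hf⟩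
  refine ⟨e, fun z t s => ?_⟩
  rw [IsometryEquiv.symm_apply_eq]
  set x := e.symm (S s z)
  have hxS : S s z = S (x.fst / c) (ζ x.snd) := (e.apply_symm_apply (S s z)).symm
  have := h.snd_flow_eq hv hxS (t - s)
  rw [add_sub_cancel] at this
  rw [this]
  change _ = S ((x.fst + (t - s) * c) / c) (ζ x.snd)
  congr 1
  field_simp

end IsProductIsometry

/-- Kleiner–Lott, "Locally Collapsed 3-Manifolds", Lemma 4.3(1): given a
`k`-splitting `X ≃ ℝᵏ ×₂ Y` and a `1`-splitting `X ≃ ℝ ×₂ Z`, either the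
`1`-splitting is compatible with the `k`-splitting (i.e. `Z ≅ ℝᵏ⁻¹ ×₂ Y`), or
there is a further splitting `Y ≅ ℝ ×₂ W` with `Z ≅ ℝᵏ ×₂ W`. -/
theorem one_splitting_compatible_or_extends {X Y Z : Type u}
    [MetricSpace X] [MetricSpace Y] [MetricSpace Z]
    (k : ℕ) (hk : 1 ≤ k)
    (e₁ : X ≃ᵢ WithLp 2 (EuclideanSpace ℝ (Fin k) × Y))
    (e₂ : X ≃ᵢ WithLp 2 (ℝ × Z)) :
    Nonempty (Z ≃ᵢ WithLp 2 (EuclideanSpace ℝ (Fin (k - 1)) × Y)) ∨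
      ∃ (W : Type u) (_ : MetricSpace W),
        Nonempty (Y ≃ᵢ WithLp 2 (ℝ × W)) ∧
        Nonempty (Z ≃ᵢ WithLp 2 (EuclideanSpace ℝ (Fin k) × W)) := by
  have h := IsProductIsometry.of_isometryEquiv (e₂.symm.trans e₁)
  obtain ⟨v, hv1, hv⟩ := h.exists_velocity
  rcases hv1.eq_or_lt with hv1 | hv1
  · exact .inl (h.nonempty_isometryEquiv_of_norm_eq_one hv hv1 (k - 1)
      (by rw [finrank_euclideanSpace_fin]; omega))
  have hpos : 0 < 1 - ‖v‖ ^ 2 := by nlinarith [norm_nonneg v]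
  have hcv : ‖v‖ ^ 2 + Real.sqrt (1 - ‖v‖ ^ 2) ^ 2 = 1 := by
    rw [Real.sq_sqrt hpos.le]; ring
  obtain ⟨e, he⟩ := h.exists_isometryEquiv_level hv (Real.sqrt_pos.2 hpos) hcv
  refine .inr ⟨_, inferInstance, ⟨e.symm⟩, ?_⟩
  refine (h.refine_snd e).nonempty_isometryEquiv_of_norm_eq_one
    (v := WithLp.toLp 2 (v, Real.sqrt (1 - ‖v‖ ^ 2))) (fun z t s => ?_) ?_ k ?_
  · rw [he z t s, ← WithLp.toLp_sub, ← WithLp.toLp_smul, Prod.mk_sub_mk, hv, Prod.smul_mk]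
    simp
  · rw [← sq_eq_sq₀ (norm_nonneg _) zero_le_one, WithLp.prod_norm_sq_eq_of_L2, one_pow]
    simpa using hcv
  · rw [(WithLp.linearEquiv 2 ℝ (EuclideanSpace ℝ (Fin k) × ℝ)).finrank_eq,
      Module.finrank_prod, finrank_euclideanSpace_fin, Module.finrank_self]
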